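/- Let R be a commutative ring, f = c_1 m_1 + ... + c_t m_t ∈ R[x_1,...,x_n] with nonzero coefficients and pairwise distinct monomials, T an integer with T ≥ max(t, 2), D an integer with D ≥ 2 and D > deg f, N_1 = ⌈n(T−1) log₂ D⌉, and let p_1, ..., p_{4N_1} be pairwise distinct primes. Let j_0 ∈ {1,...,4N_1} be an index such that #f^mod_{(D,p_{j_0})} ≥ #f^mod_{(D,p_j)} for all j ∈ {1,...,4N_1}. Then at least ⌊t/2⌋ of the t terms of f are not collisions in f^mod_{(D,p_{j_0})}. -/

import Mathlib

open Polynomial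

/-- Kronecker value of a monomial `m = x₁^{e₁}⋯xₙ^{eₙ}`:
`K(m) = e₁ + e₂ D + ⋯ + eₙ D^{n-1}`. -/
noncomputable def kval {n : ℕ} (D : ℕ) (m : Fin n →₀ ℕ) : ℕ :=
  ∑ i, m i * D ^ (i : ℕ)

/-- `f^mod_{(D,p)} = f(x, x^D, …, x^{D^{n-1}}) mod (x^p - 1)`. -/
noncomputable def fmod {R : Type*} [CommRing R] {n : ℕ} (D p : ℕ)
    (f : MvPolynomial (Fin n) R) : Polynomial R :=
  ∑ m ∈ f.support, Polynomial.monomial (kval D m % p) (MvPolynomial.coeff m f)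

/-- The indices at which `r` takes a value that it takes nowhere else. -/
def isolated {ι α : Type*} [Fintype ι] [DecidableEq ι] [DecidableEq α] (r : ι → α) : Finset ι :=
  Finset.univ.filter fun i => ¬ ∃ l, l ≠ i ∧ r l = r i

theorem mem_isolated {ι α : Type*} [Fintype ι] [DecidableEq ι] [DecidableEq α] {r : ι → α}
    {i : ι} : i ∈ isolated r ↔ ∀ l, r l = r i → l = i := by
  simp only [isolated, Finset.mem_filter, Finset.mem_univ, true_and]
  grind

theorem two_mul_card_image_le {ι α : Type*} [Fintype ι] [DecidableEq ι] [DecidableEq α]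
    (r : ι → α) :
    2 * (Finset.univ.image r).card ≤ Fintype.card ι + (isolated r).card := by
  have h1 : Fintype.card ι = ∑ b ∈ Finset.univ.image r,
      (Finset.univ.filter fun i => r i = b).card :=
    Finset.card_eq_sum_card_fiberwise fun i _ => by simp
  have h2 : (isolated r).card = ∑ b ∈ Finset.univ.image r,
      ((isolated r).filter fun i => r i = b).card :=
    Finset.card_eq_sum_card_fiberwise fun i _ => by simp
  rw [h1, h2, ← Finset.sum_add_distrib, mul_comm, ← smul_eq_mul]
  refine Finset.card_nsmul_le_sum _ _ _ fun b hb => ?_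
  obtain ⟨i, -, rfl⟩ := Finset.mem_image.mp hb
  by_cases hi : i ∈ isolated r
  · have h3 : 0 < (Finset.univ.filter fun l => r l = r i).card :=
      Finset.card_pos.mpr ⟨i, by simp⟩
    have h4 : 0 < ((isolated r).filter fun l => r l = r i).card :=
      Finset.card_pos.mpr ⟨i, by simp [hi]⟩
    omega
  · rw [mem_isolated] at hi
    push Not at hi
    obtain ⟨l, hl, hne⟩ := hi
    have h3 : 1 < (Finset.univ.filter fun l => r l = r i).card :=
      Finset.one_lt_card.mpr ⟨l, by simp [hl], i, by simp, hne⟩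
    omega

theorem support_sum_monomial_subset {R ι : Type*} [Semiring R] [Fintype ι]
    (r : ι → ℕ) (c : ι → R) :
    (∑ i, Polynomial.monomial (r i) (c i)).support ⊆ Finset.univ.image r := by
  intro k hk
  rw [Polynomial.mem_support_iff, Polynomial.finsetSum_coeff] at hk
  obtain ⟨i, -, hi⟩ := Finset.exists_ne_zero_of_sum_ne_zero hk
  rw [Polynomial.coeff_monomial] at hi
  exact Finset.mem_image.mpr ⟨i, Finset.mem_univ i, by grind⟩

theorem card_isolated_le_card_support {R ι : Type*} [Semiring R] [Fintype ι] [DecidableEq ι]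
    (r : ι → ℕ) (c : ι → R) (hc : ∀ i, c i ≠ 0) :
    (isolated r).card ≤ (∑ i, Polynomial.monomial (r i) (c i)).support.card := by
  refine Finset.card_le_card_of_injOn r (fun i hi => ?_) fun i hi l hl h => ?_
  · have hi' := mem_isolated.mp hi
    rw [Finset.mem_coe, Polynomial.mem_support_iff, Polynomial.finsetSum_coeff,
      Finset.sum_eq_single i]
    · simpa using hc i
    · intro l _ hl
      exact Polynomial.coeff_monomial_of_ne _ fun h => hl (hi' l h.symm)
    · simp
  · exact mem_isolated.mp hl i h

theorem kval_eq_finFunctionFinEquiv {n D : ℕ} (m : Fin n →₀ ℕ) (hm : ∀ i, m i < D) :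
    kval D m = finFunctionFinEquiv fun i => (⟨m i, hm i⟩ : Fin D) := by
  simp [kval]

theorem kval_lt_pow {n D : ℕ} (m : Fin n →₀ ℕ) (hm : ∀ i, m i < D) : kval D m < D ^ n := by
  rw [kval_eq_finFunctionFinEquiv m hm]
  exact Fin.is_lt _

theorem eq_of_kval_eq {n D : ℕ} {m m' : Fin n →₀ ℕ} (hm : ∀ i, m i < D) (hm' : ∀ i, m' i < D)
    (h : kval D m = kval D m') : m = m' := by
  rw [kval_eq_finFunctionFinEquiv m hm, kval_eq_finFunctionFinEquiv m' hm'] at h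
  have h' := finFunctionFinEquiv.injective (Fin.ext h)
  ext i
  simpa using congrFun h' i

theorem two_pow_card_le_of_prime_dvd {κ : Type*} (S : Finset κ) (p : κ → ℕ)
    (hinj : Function.Injective p) (hpr : ∀ j, (p j).Prime) {P : ℕ} (hP : P ≠ 0)
    (hdvd : ∀ j ∈ S, p j ∣ P) : 2 ^ S.card ≤ P :=
  calc 2 ^ S.card ≤ ∏ j ∈ S, p j := Finset.pow_card_le_prod _ _ _ fun j _ => (hpr j).two_le
    _ ≤ P := Nat.le_of_dvd (Nat.pos_of_ne_zero hP) <|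
      Finset.prod_dvd_of_isRelPrime (fun j _ l _ hjl => Nat.coprime_iff_isRelPrime.mp <|
        (Nat.coprime_primes (hpr j) (hpr l)).mpr (hinj.ne hjl)) hdvd

/-- If `K` takes distinct values below `B`, then modulo at most `logb 2 (B ^ (#ι - 1))` primes
does a given value of `K` become equal to another one. -/
theorem two_pow_card_colliding_primes_le {ι κ : Type*} [Fintype ι] [DecidableEq ι] [Fintype κ]
    (K : ι → ℕ) (hK : Function.Injective K) {B : ℕ} (hB : ∀ i, K i < B)
    (p : κ → ℕ) (hinj : Function.Injective p) (hpr : ∀ j, (p j).Prime) (i : ι) :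
    2 ^ (Finset.univ.filter fun j => i ∉ isolated fun l => K l % p j).card
      ≤ B ^ (Fintype.card ι - 1) := by
  have hP : ∏ l ∈ Finset.univ.erase i, ((K l : ℤ) - K i).natAbs ≠ 0 := by
    refine Finset.prod_ne_zero_iff.mpr fun l hl h => (Finset.mem_erase.mp hl).1 (hK ?_)
    omega
  refine (two_pow_card_le_of_prime_dvd _ p hinj hpr hP fun j hj => ?_).trans ?_
  · simp only [Finset.mem_filter, Finset.mem_univ, true_and, mem_isolated] at hj
    push Not at hj
    obtain ⟨l, hl, hne⟩ := hj
    refine dvd_trans ?_ (Finset.dvd_prod_of_mem _ (Finset.mem_erase.mpr ⟨hne, Finset.mem_univ l⟩))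
    rw [← Int.natCast_dvd]
    exact Nat.modEq_iff_dvd.mp (Eq.symm hl)
  · refine (Finset.prod_le_pow_card _ _ B fun l _ => ?_).trans (by simp [Finset.card_erase_of_mem])
    have := hB l
    have := hB i
    omega

theorem stmt8 {R : Type*} [CommRing R] {n t : ℕ}
    (c : Fin t → R) (e : Fin t → (Fin n →₀ ℕ))
    (hc : ∀ i, c i ≠ 0) (he : Function.Injective e)
    (f : MvPolynomial (Fin n) R)
    (hf : f = ∑ i, MvPolynomial.monomial (e i) (c i))
    (T D N1 : ℕ) (hT : max t 2 ≤ T) (hD2 : 2 ≤ D) (hD : f.totalDegree < D)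
    (hN1 : N1 = ⌈(↑(n * (T - 1)) : ℝ) * Real.logb 2 D⌉₊)
    (p : Fin (4 * N1) → ℕ) (hinj : Function.Injective p)
    (hpr : ∀ j, (p j).Prime)
    (j0 : Fin (4 * N1))
    (hj0 : ∀ j, (fmod D (p j) f).support.card ≤ (fmod D (p j0) f).support.card) :
    t / 2 ≤ (Finset.univ.filter fun i : Fin t =>
      ¬ ∃ l, l ≠ i ∧ kval D (e l) % p j0 = kval D (e i) % p j0).card := by
  have hcoeff : ∀ i, MvPolynomial.coeff (e i) f = c i := by
    intro i
    simp [hf, MvPolynomial.coeff_sum, MvPolynomial.coeff_monomial, he.eq_iff]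
  have hsupp : f.support = Finset.univ.image e := by
    ext m
    simp only [Finset.mem_image, Finset.mem_univ, true_and, MvPolynomial.mem_support_iff]
    constructor
    · intro hm
      rw [hf, MvPolynomial.coeff_sum] at hm
      obtain ⟨i, -, hi⟩ := Finset.exists_ne_zero_of_sum_ne_zero hm
      rw [MvPolynomial.coeff_monomial] at hi
      exact ⟨i, by grind⟩
    · rintro ⟨i, rfl⟩
      rw [hcoeff]
      exact hc i
  have hfmod : ∀ q, fmod D q f = ∑ i, Polynomial.monomial (kval D (e i) % q) (c i) := by
    intro q
    rw [fmod, hsupp, Finset.sum_image he.injOn]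
    simp only [hcoeff]
  have hlt : ∀ i k, e i k < D := fun i k =>
    ((MvPolynomial.le_degreeOf_of_mem_support k (by simp [hsupp])).trans
      (MvPolynomial.degreeOf_le_totalDegree f k)).trans_lt hD
  have hK : Function.Injective fun i => kval D (e i) := fun i l h =>
    he (eq_of_kval_eq (hlt i) (hlt l) h)
  let I : Fin (4 * N1) → Finset (Fin t) := fun j => isolated fun i => kval D (e i) % p j
  have hbad : ∀ i, (Finset.univ.filter fun j => i ∉ I j).card ≤ N1 := by
    intro i
    have h := two_pow_card_colliding_primes_le _ hK (fun l => kval_lt_pow _ (hlt l)) p hinj hpr i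
    rw [Fintype.card_fin, ← pow_mul] at h
    replace h := h.trans (Nat.pow_le_pow_right (by omega : 0 < D)
      (Nat.mul_le_mul_left n (by omega : t - 1 ≤ T - 1)))
    have hlog : ((Finset.univ.filter fun j => i ∉ I j).card : ℝ)
        ≤ (↑(n * (T - 1)) : ℝ) * Real.logb 2 D := by
      rw [← Real.logb_pow, Real.le_logb_iff_rpow_le one_lt_two (by positivity), Real.rpow_natCast]
      exact_mod_cast h
    exact_mod_cast hlog.trans ((Nat.le_ceil _).trans_eq (congrArg Nat.cast hN1.symm))
  have hsum : ∑ j, (Finset.univ.filter fun i => i ∉ I j).card ≤ t * N1 := by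
    calc ∑ j, (Finset.univ.filter fun i => i ∉ I j).card
        = ∑ i, (Finset.univ.filter fun j => i ∉ I j).card :=
          Finset.sum_card_bipartiteAbove_eq_sum_card_bipartiteBelow fun j i => i ∉ I j
      _ ≤ ∑ _i : Fin t, N1 := Finset.sum_le_sum fun i _ => hbad i
      _ = t * N1 := by simp
  obtain ⟨j, hj⟩ : ∃ j, 4 * (Finset.univ.filter fun i => i ∉ I j).card ≤ t := by
    by_contra! h
    have h1 : ∑ _j : Fin (4 * N1), (t + 1)
        ≤ ∑ j, 4 * (Finset.univ.filter fun i => i ∉ I j).card :=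
      Finset.sum_le_sum fun j _ => h j
    rw [← Finset.mul_sum, Finset.sum_const, Finset.card_univ, Fintype.card_fin, smul_eq_mul] at h1
    have hpos : 0 < N1 := by have := j0.isLt; omega
    nlinarith
  have hcompl : (I j).card + (Finset.univ.filter fun i => i ∉ I j).card = t := by
    simpa using Finset.card_filter_add_card_filter_not (s := Finset.univ) (fun i => i ∈ I j)
  have hlow := card_isolated_le_card_support (fun i => kval D (e i) % p j) c hc
  have hup := (Finset.card_le_card
    (support_sum_monomial_subset (fun i => kval D (e i) % p j0) c))
  have hhalf := two_mul_card_image_le fun i => kval D (e i) % p j0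
  rw [Fintype.card_fin] at hhalf
  have hmax := hj0 j
  rw [hfmod, hfmod] at hmax
  change (I j).card ≤ _ at hlow
  have hgoal : t / 2 ≤ (isolated fun i => kval D (e i) % p j0).card := by omega
  convert hgoal using 2
  ext i
  simp [isolated]
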